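/- Let A, B, C be affinely independent points in the Euclidean plane, with a = dist B C, b = dist C A, c = dist A B, s = (a+b+c)/2. Let D be the Gergonne point of triangle ABC and let E be the Nagel point of triangle ABC (the common point of the cevians from each vertex to the point on the opposite side at distance s − c from B on BC, s − a from C on CA, and s − b from A on AB, respectively). Then the line AD is perpendicular to the line BE if and only if the line BD is perpendicular to the line AE; that is, ⟪D − A, E − B⟫ = 0 if and only if ⟪D − B, E − A⟫ = 0. -/

import Mathlib

open EuclideanGeometry Real MeasureTheory RealInnerProductSpace

noncomputable def area (P Q R : EuclideanSpace ℝ (Fin 2)) : ℝ :=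
  (MeasureTheory.volume (convexHull ℝ ({P, Q, R} : Set (EuclideanSpace ℝ (Fin 2))))).toReal

theorem seg_aux {B C X : EuclideanSpace ℝ (Fin 2)} {d : ℝ}
    (hX : X ∈ segment ℝ B C) (hd : dist B X = d) :
    ∃ t : ℝ, X = B + t • (C - B) ∧ t * dist B C = d := by
  rw [segment_eq_image'] at hX
  obtain ⟨t, ht, rfl⟩ := hX
  refine ⟨t, rfl, ?_⟩
  rw [← hd, dist_eq_norm, dist_eq_norm]
  have : B - (B + t • (C - B)) = t • (B - C) := by module
  rw [this, norm_smul, Real.norm_eq_abs, abs_of_nonneg ht.1]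

theorem line_aux {A X D : EuclideanSpace ℝ (Fin 2)}
    (h : D ∈ affineSpan ℝ ({A, X} : Set (EuclideanSpace ℝ (Fin 2)))) :
    ∃ r : ℝ, D = A + r • (X - A) := by
  obtain ⟨r, rfl⟩ := mem_affineSpan_pair_iff_exists_lineMap_eq.1 h
  refine ⟨r, ?_⟩
  simp [AffineMap.lineMap_apply]
  abel

theorem lt_aux {A B C : EuclideanSpace ℝ (Fin 2)}
    (h : AffineIndependent ℝ ![A, B, C]) : dist A C < dist A B + dist B C := by
  refine lt_of_le_of_ne (dist_triangle _ _ _) fun he => ?_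
  have hw := dist_add_dist_eq_iff.1 he.symm
  exact (affineIndependent_iff_not_collinear_set.1 h) hw.collinear

theorem cevian_aux {A B C X Y D : EuclideanSpace ℝ (Fin 2)} {a b p q t t' : ℝ}
    (hli : ∀ m n : ℝ, m • (B - A) + n • (C - A) = 0 → m = 0 ∧ n = 0)
    (ha : a ≠ 0) (hb : b ≠ 0)
    (hX : X = B + t • (C - B)) (ht : t * a = p)
    (hY : Y = C + t' • (A - C)) (ht' : t' * b = q)
    (hD1 : D ∈ affineSpan ℝ ({A, X} : Set (EuclideanSpace ℝ (Fin 2))))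
    (hD2 : D ∈ affineSpan ℝ ({B, Y} : Set (EuclideanSpace ℝ (Fin 2)))) :
    ∃ ρ : ℝ, D - A = ρ • ((a - p) • (B - A) + p • (C - A)) ∧
      ρ * (p * b + (a - p) * (b - q)) = b - q := by
  obtain ⟨r, hr⟩ := line_aux hD1
  obtain ⟨k, hk⟩ := line_aux hD2
  subst hX hY ht ht'
  have h0 := hli (r * (1 - t) - (1 - k)) (r * t - k * (1 - t')) (by
    have : (r * (1 - t) - (1 - k)) • (B - A) + (r * t - k * (1 - t')) • (C - A)
      = (A + r • (B + t • (C - B) - A)) - (B + k • (C + t' • (A - C) - B)) := by module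
    rw [this, ← hr, ← hk, sub_self])
  obtain ⟨h1, h2⟩ := h0
  refine ⟨r / a, ?_, ?_⟩
  · rw [hr]
    have e1 : r = (r / a) * a := by field_simp
    generalize r / a = ρ at *
    subst e1
    module
  · field_simp
    linear_combination (1 - t') * h1 + h2

theorem poly_aux {V : Type*} [NormedAddCommGroup V] [InnerProductSpace ℝ V] (u v d e : V)
    (x y z ρ σ : ℝ) (hu : ‖u‖ = x + y) (hv : ‖v‖ = x + z) (huv : ‖u - v‖ = y + z)
    (hd : d = ρ • (z • u + y • v)) (he : e = σ • (y • u + z • v))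
    (hρ : ρ * (x * y + y * z + z * x) = x) (hσ : σ * (x + y + z) = 1)
    (hx : 0 < x) (hy : 0 < y) (hz : 0 < z) :
    inner ℝ d (e - u) = 0 ↔ inner ℝ (d - u) e = 0 := by
  have h1 : inner ℝ u u = (x + y) ^ 2 := by rw [real_inner_self_eq_norm_sq, hu]
  have h2 : inner ℝ v v = (x + z) ^ 2 := by rw [real_inner_self_eq_norm_sq, hv]
  have h3 : inner ℝ u v = x ^ 2 + x * y + x * z - y * z := by
    have := norm_sub_sq_real u v
    rw [hu, hv, huv] at this
    linarith
  have h4 : inner ℝ v u = x ^ 2 + x * y + x * z - y * z := by rw [real_inner_comm, h3]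
  have hG : 0 < x * y + y * z + z * x := by positivity
  have hS : 0 < x + y + z := by positivity
  obtain rfl : ρ = x / (x * y + y * z + z * x) := by field_simp; linarith
  obtain rfl : σ = 1 / (x + y + z) := by field_simp; linarith
  have e1 : inner ℝ d (e - u) = x ^ 2 * ((z ^ 3 - x ^ 2 * z - y ^ 2 * z - x ^ 2 * y - x * y ^ 2
      - 3 * x * y * z) / ((x * y + y * z + z * x) * (x + y + z))) := by
    rw [hd, he]
    simp only [inner_sub_right, inner_add_left, inner_add_right, inner_smul_left,
      inner_smul_right, h1, h2, h3, h4, conj_trivial]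
    field_simp
    ring
  have e2 : inner ℝ (d - u) e = y ^ 2 * ((z ^ 3 - x ^ 2 * z - y ^ 2 * z - x ^ 2 * y - x * y ^ 2
      - 3 * x * y * z) / ((x * y + y * z + z * x) * (x + y + z))) := by
    rw [hd, he]
    simp only [inner_sub_left, inner_add_left, inner_add_right, inner_smul_left,
      inner_smul_right, h1, h2, h3, h4, conj_trivial]
    field_simp
    ring
  rw [e1, e2]
  simp only [mul_eq_zero, pow_eq_zero_iff two_ne_zero, hx.ne', hy.ne', false_or]

theorem gergonne_nagel_perp_iff
    (A B C D E : EuclideanSpace ℝ (Fin 2))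
    (hABC : AffineIndependent ℝ ![A, B, C])
    (a b c s : ℝ)
    (ha : a = dist B C) (hb : b = dist C A) (hc : c = dist A B)
    (hs : s = (a + b + c) / 2)
    (X Y Z : EuclideanSpace ℝ (Fin 2))
    (hX : X ∈ segment ℝ B C) (hXd : dist B X = s - b)
    (hY : Y ∈ segment ℝ C A) (hYd : dist C Y = s - c)
    (hZ : Z ∈ segment ℝ A B) (hZd : dist A Z = s - a)
    (hD1 : D ∈ affineSpan ℝ ({A, X} : Set (EuclideanSpace ℝ (Fin 2))))
    (hD2 : D ∈ affineSpan ℝ ({B, Y} : Set (EuclideanSpace ℝ (Fin 2))))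
    (hD3 : D ∈ affineSpan ℝ ({C, Z} : Set (EuclideanSpace ℝ (Fin 2))))
    (X' Y' Z' : EuclideanSpace ℝ (Fin 2))
    (hX' : X' ∈ segment ℝ B C) (hX'd : dist B X' = s - c)
    (hY' : Y' ∈ segment ℝ C A) (hY'd : dist C Y' = s - a)
    (hZ' : Z' ∈ segment ℝ A B) (hZ'd : dist A Z' = s - b)
    (hE1 : E ∈ affineSpan ℝ ({A, X'} : Set (EuclideanSpace ℝ (Fin 2))))
    (hE2 : E ∈ affineSpan ℝ ({B, Y'} : Set (EuclideanSpace ℝ (Fin 2))))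
    (hE3 : E ∈ affineSpan ℝ ({C, Z'} : Set (EuclideanSpace ℝ (Fin 2)))) :
    (inner ℝ (D - A) (E - B) : ℝ) = 0 ↔ (inner ℝ (D - B) (E - A) : ℝ) = 0 := by
  have hnc := affineIndependent_iff_not_collinear_set.1 hABC
  have t1 : b < c + a := by
    rw [hb, hc, ha, dist_comm C A]; exact lt_aux hABC
  have t2 : c < b + a := by
    have : AffineIndependent ℝ ![A, C, B] := by
      rw [affineIndependent_iff_not_collinear_set]
      rwa [Set.pair_comm C B]
    have := lt_aux this
    rw [hb, hc, ha, dist_comm C A, dist_comm B C]; exact this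
  have t3 : a < c + b := by
    have : AffineIndependent ℝ ![B, A, C] := by
      rw [affineIndependent_iff_not_collinear_set]
      rwa [Set.insert_comm B A]
    have := lt_aux this
    rw [hb, hc, ha, dist_comm C A, dist_comm A B]; exact this
  have hli : ∀ m n : ℝ, m • (B - A) + n • (C - A) = 0 → m = 0 ∧ n = 0 := by
    rw [← LinearIndependent.pair_iff]
    rw [affineIndependent_iff_linearIndependent_vsub ℝ _ (0 : Fin 3)] at hABC
    have h := hABC.comp (![⟨1, by decide⟩, ⟨2, by decide⟩] : Fin 2 → {x : Fin 3 // x ≠ 0}) (by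
      intro i j hij
      fin_cases i <;> fin_cases j <;> simp_all)
    convert h using 1
    ext i
    fin_cases i <;> simp
  have ha0 : a ≠ 0 := by linarith
  have hb0 : b ≠ 0 := by linarith
  obtain ⟨t, hXt, ht⟩ := seg_aux hX hXd
  obtain ⟨t', hYt, ht'⟩ := seg_aux hY hYd
  obtain ⟨w, hXw, hw⟩ := seg_aux hX' hX'd
  obtain ⟨w', hYw, hw'⟩ := seg_aux hY' hY'd
  rw [← ha] at ht hw
  rw [← hb] at ht' hw'
  obtain ⟨ρ, hD, hρ⟩ := cevian_aux hli ha0 hb0 hXt ht hYt ht' hD1 hD2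
  obtain ⟨σ, hE, hσ⟩ := cevian_aux hli ha0 hb0 hXw hw hYw hw' hE1 hE2
  have key := poly_aux (B - A) (C - A) (D - A) (E - A) (s - a) (s - b) (s - c) ρ σ
    (by rw [← dist_eq_norm, dist_comm, ← hc]; linarith)
    (by rw [← dist_eq_norm, ← hb]; linarith)
    (by rw [sub_sub_sub_cancel_right, ← dist_eq_norm, ← ha]; linarith)
    (by rw [hD, show a - (s - b) = s - c by linarith])
    (by rw [hE, show a - (s - c) = s - b by linarith])
    (by subst hs; linear_combination hρ)
    (by
      have hz : s - c ≠ 0 := by linarith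
      apply mul_right_cancel₀ hz
      subst hs; linear_combination hσ)
    (by linarith) (by linarith) (by linarith)
  simpa only [sub_sub_sub_cancel_right] using key
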